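/- Let ℓ ≥ 2 and let M = (φ_j(x_i))_{1≤i,j≤ℓ} be the ℓ×ℓ matrix over S whose (i,j) entry is φ_j(x_i). Then det M is nonzero, its initial monomial in the pure lexicographic order is ∏_{i=1}^{ℓ−1} x_i^{4(ℓ−i)}, and its leading term is (1/(2ℓ−3)!!)·∏_{i=1}^{ℓ−1} x_i^{4(ℓ−i)}, where (2ℓ−3)!! = ∏_{m=1}^{ℓ−1}(2m−1). -/

import Mathlib

open MvPolynomial Finset

noncomputable section

/-- Elementary symmetric function of degree `n` of the values of `f` on the finite set `s`. -/
def esymVal {α R : Type*} [CommSemiring R] (s : Finset α) (f : α → R) (n : ℕ) : R :=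
  ∑ t ∈ Finset.powersetCard n s, ∏ a ∈ t, f a

/-- The characterizing conditions for the family of Bernoulli-like polynomials `B p q`
(for `p ≥ -1`, `q ≥ 0`, `(p,q) ≠ (-1,0)`):  oddness and the (denominator-cleared)
difference equations. -/
def BProp (B : ℤ → ℕ → Polynomial ℝ) : Prop :=
  (∀ (p : ℤ) (q : ℕ), -1 ≤ p → ¬(p = -1 ∧ q = 0) →
      (B p q).comp (-Polynomial.X) = -(B p q)) ∧
  (∀ (p q : ℕ),
      (2 * Polynomial.X + 1) * ((B p q).comp (Polynomial.X + 1) - B p q)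
        = ((Polynomial.X + 1) ^ p - (-Polynomial.X) ^ p)
            * (Polynomial.X + 1) ^ q * (-Polynomial.X) ^ q) ∧
  (∀ q : ℕ, 1 ≤ q →
      (B (-1) q).comp (Polynomial.X + 1) - B (-1) q
        = -((-Polynomial.X) * (Polynomial.X + 1)) ^ (q - 1))

/-- The polynomial ring `S = ℝ[x_1, …, x_ℓ, z]`; the variable indexed by
`Fin.castSucc i` is `x_{i+1}` and the variable indexed by `Fin.last ℓ` is `z`. -/
abbrev SS (ℓ : ℕ) := MvPolynomial (Fin (ℓ + 1)) ℝ

/-- The field of rational functions, in which the defining formulas for the `φ_j` live. -/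
abbrev KK (ℓ : ℕ) := FractionRing (SS ℓ)

/-- `x_{i+1}` as a rational function. -/
def xx (ℓ : ℕ) (i : Fin ℓ) : KK ℓ := algebraMap (SS ℓ) (KK ℓ) (X i.castSucc)

/-- `z` as a rational function. -/
def zz (ℓ : ℕ) : KK ℓ := algebraMap (SS ℓ) (KK ℓ) (X (Fin.last ℓ))

/-- `ar B_{p,q}(x, z) = z^{p+2q}·B_{p,q}(x/z)`, as a rational function; by convention
`ar B_{-1,0}(x,z) = -1/x`. -/
def arB (B : ℤ → ℕ → Polynomial ℝ) (ℓ : ℕ) (p : ℤ) (q : ℕ) (x : KK ℓ) : KK ℓ :=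
  if p = -1 ∧ q = 0 then -x⁻¹
  else zz ℓ ^ (p + 2 * (q : ℤ)) *
    Polynomial.eval₂ ((algebraMap (SS ℓ) (KK ℓ)).comp (MvPolynomial.C)) (x / zz ℓ) (B p q)

/-- `J = {x_1, …, x_{j-1}}` (as a set of indices). -/
def Jset (ℓ : ℕ) (j : Fin ℓ) : Finset (Fin ℓ) := univ.filter (· < j)

/-- The value `φ_j(x_i)` (an element of the fraction field, which is in fact
a polynomial).  Here `j` with `(j:ℕ)+1 < ℓ` encodes `φ_{j+1}`, `1 ≤ j+1 ≤ ℓ-1`,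
and `j = Fin.last` encodes `φ_ℓ`. -/
def phi (B : ℤ → ℕ → Polynomial ℝ) (ℓ : ℕ) (j i : Fin ℓ) : KK ℓ :=
  if h : (j : ℕ) + 1 < ℓ then
    (xx ℓ j - xx ℓ ⟨(j : ℕ) + 1, h⟩ - zz ℓ) *
      ∑ K1 ∈ (Jset ℓ j).powerset, ∑ K2 ∈ ((Jset ℓ j) \ K1).powerset,
        (∏ a ∈ K1, xx ℓ a) * (∏ a ∈ K2, xx ℓ a) ^ 2 * (-zz ℓ) ^ K1.card *
          ∑ n1 ∈ Finset.range 3, ∑ n2 ∈ Finset.range (ℓ - (j : ℕ) - 1),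
            (-1 : KK ℓ) ^ (n1 + n2) *
              esymVal ({j, ⟨(j : ℕ) + 1, h⟩} : Finset (Fin ℓ)) (xx ℓ) n1 *
              esymVal (univ.filter (fun a : Fin ℓ => (j : ℕ) + 1 < (a : ℕ)))
                (fun a => xx ℓ a ^ 2) n2 *
              arB B ℓ ((2 - (n1 : ℤ)) + 2 * ((ℓ : ℤ) - (j : ℤ) - 2 - (n2 : ℤ)) - 1)
                ((j : ℕ) - K1.card - K2.card) (xx ℓ i)
  else
    ∑ K1 ∈ (Jset ℓ j).powerset, ∑ K2 ∈ ((Jset ℓ j) \ K1).powerset,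
      (∏ a ∈ K1, xx ℓ a) * (∏ a ∈ K2, xx ℓ a) ^ 2 * (-zz ℓ) ^ K1.card * (-(xx ℓ j)) *
        arB B ℓ (-1) ((j : ℕ) - K1.card - K2.card) (xx ℓ i)


/-- The exponent vector of the monomial `∏_{i=1}^{ℓ−1} x_i^{4(ℓ−i)}`. -/
def expoD (ℓ : ℕ) : Fin (ℓ + 1) →₀ ℕ :=
  Finsupp.equivFunOnFinite.symm fun p => 4 * (ℓ - 1 - (p : ℕ))

/-! ### Bounds on the weights of the monomials of a polynomial -/

/-- Every monomial of `f` has `w`-weight at most `n`. -/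
def WeightLE {σ R : Type*} [CommRing R] (w : σ → ℕ) (f : MvPolynomial σ R) (n : ℕ) : Prop :=
  ∀ d ∈ f.support, Finsupp.weight w d ≤ n

namespace WeightLE

variable {σ R ι : Type*} [CommRing R] {w : σ → ℕ} {f g : MvPolynomial σ R} {m n : ℕ}

theorem mono (hf : WeightLE w f m) (h : m ≤ n) : WeightLE w f n :=
  fun d hd => (hf d hd).trans h

theorem add (hf : WeightLE w f n) (hg : WeightLE w g n) : WeightLE w (f + g) n := by
  classical
  intro d hd
  rcases Finset.mem_union.1 (MvPolynomial.support_add hd) with h | h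
  exacts [hf d h, hg d h]

theorem neg (hf : WeightLE w f n) : WeightLE w (-f) n := by
  intro d hd
  exact hf d (by simpa using hd)

theorem sub (hf : WeightLE w f n) (hg : WeightLE w g n) : WeightLE w (f - g) n := by
  rw [sub_eq_add_neg]
  exact hf.add hg.neg

theorem sum {s : Finset ι} {F : ι → MvPolynomial σ R} (h : ∀ i ∈ s, WeightLE w (F i) n) :
    WeightLE w (∑ i ∈ s, F i) n := by
  classical
  intro d hd
  obtain ⟨i, hi, hd⟩ := Finset.mem_biUnion.1 (MvPolynomial.support_sum hd)
  exact h i hi d hd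

theorem mul (hf : WeightLE w f m) (hg : WeightLE w g n) : WeightLE w (f * g) (m + n) := by
  classical
  intro d hd
  obtain ⟨a, ha, b, hb, rfl⟩ := Finset.mem_add.1 (MvPolynomial.support_mul f g hd)
  rw [map_add]
  exact Nat.add_le_add (hf a ha) (hg b hb)

theorem const (a : R) : WeightLE w (C a : MvPolynomial σ R) n := by
  classical
  intro d hd
  have : d = 0 := by
    by_contra h
    rw [MvPolynomial.mem_support_iff, MvPolynomial.coeff_C, if_neg (Ne.symm h)] at hd
    exact hd rfl
  simp [this]

theorem one : WeightLE w (1 : MvPolynomial σ R) n := by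
  simpa using const (w := w) (n := n) (1 : R)

theorem var (i : σ) (h : w i ≤ n) : WeightLE w (X i : MvPolynomial σ R) n := by
  classical
  intro d hd
  have : d = Finsupp.single i 1 := by
    by_contra h
    rw [MvPolynomial.mem_support_iff, MvPolynomial.coeff_X, if_neg (Ne.symm h)] at hd
    exact hd rfl
  simpa [this, Finsupp.weight_single] using h

theorem pow (hf : WeightLE w f n) (k : ℕ) : WeightLE w (f ^ k) (k * n) := by
  induction k with
  | zero => simpa using one
  | succ k ih =>
    rw [pow_succ, Nat.succ_mul]
    exact ih.mul hf

theorem prod {s : Finset ι} {F : ι → MvPolynomial σ R} {b : ι → ℕ}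
    (h : ∀ i ∈ s, WeightLE w (F i) (b i)) : WeightLE w (∏ i ∈ s, F i) (∑ i ∈ s, b i) := by
  classical
  induction s using Finset.induction_on with
  | empty => simpa using one
  | insert a s ha ih =>
    rw [Finset.prod_insert ha, Finset.sum_insert ha]
    exact (h a (by simp)).mul (ih fun i hi => h i (by simp [hi]))

theorem esymVal {s : Finset ι} {F : ι → MvPolynomial σ R} {b : ι → ℕ} {k : ℕ}
    (h : ∀ i ∈ s, WeightLE w (F i) (b i)) (hk : ∀ t ⊆ s, t.card = k → ∑ i ∈ t, b i ≤ n) :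
    WeightLE w (esymVal s F k) n := by
  refine sum fun t ht => ?_
  rw [Finset.mem_powersetCard] at ht
  exact (prod fun i hi => h i (ht.1 hi)).mono (hk t ht.1 ht.2)

theorem coeff_eq_zero (hf : WeightLE w f n) {d : σ →₀ ℕ} (hd : n < Finsupp.weight w d) :
    f.coeff d = 0 := by
  by_contra h
  exact absurd (hf d (MvPolynomial.mem_support_iff.2 h)) (by omega)

end WeightLE

/-! ### Lexicographic comparison and products -/

theorem exists_sum_of_mem_support_prod {σ R ι : Type*} [CommSemiring R] (s : Finset ι)
    (f : ι → MvPolynomial σ R) {d : σ →₀ ℕ} (hd : d ∈ (∏ i ∈ s, f i).support) :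
    ∃ m : ι → σ →₀ ℕ, (∀ i ∈ s, m i ∈ (f i).support) ∧ d = ∑ i ∈ s, m i := by
  classical
  induction s using Finset.induction_on generalizing d with
  | empty =>
    refine ⟨0, by simp, ?_⟩
    by_contra h
    rw [Finset.prod_empty, MvPolynomial.mem_support_iff, MvPolynomial.coeff_one] at hd
    exact hd (if_neg fun h' => h (by simp [← h']))
  | insert a s ha ih =>
    rw [Finset.prod_insert ha] at hd
    obtain ⟨b, hb, c, hc, rfl⟩ := Finset.mem_add.1 (MvPolynomial.support_mul _ _ hd)
    obtain ⟨m, hm, rfl⟩ := ih hc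
    refine ⟨Function.update m a b, ?_, ?_⟩
    · intro i hi
      rcases Finset.mem_insert.1 hi with rfl | hi
      · simpa using hb
      · rw [Function.update_of_ne (ne_of_mem_of_not_mem hi ha)]
        exact hm i hi
    · rw [Finset.sum_insert ha, Function.update_self]
      congr 1
      exact Finset.sum_congr rfl fun i hi => by
        rw [Function.update_of_ne (ne_of_mem_of_not_mem hi ha)]

theorem toLex_lt_of_sum_lt {n : ℕ} {d e : Fin n →₀ ℕ} (i : Fin n)
    (hle : ∀ c < i, d c ≤ e c) (hlt : ∑ c ∈ Finset.Iic i, d c < ∑ c ∈ Finset.Iic i, e c) :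
    toLex d < toLex e := by
  obtain ⟨c, hc, hce⟩ := Finset.exists_lt_of_sum_lt hlt
  have hne : (univ.filter fun c => d c ≠ e c).Nonempty := ⟨c, by simp [hce.ne]⟩
  set k := (univ.filter fun c => d c ≠ e c).min' hne with hk
  have hkne : d k ≠ e k := by
    simpa using Finset.min'_mem _ hne
  have hmin : ∀ j < k, d j = e j := by
    intro j hj
    by_contra h
    exact absurd (Finset.min'_le (univ.filter fun c => d c ≠ e c) j (by simp [h])) (not_le.2 hj)
  refine Finsupp.Lex.lt_iff.2 ⟨k, hmin, ?_⟩
  have hkc : k ≤ c := Finset.min'_le _ _ (by simp [hce.ne])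
  have hki : k ≤ i := hkc.trans (Finset.mem_Iic.1 hc)
  rcases hki.lt_or_eq with h | h
  · exact lt_of_le_of_ne (hle k h) hkne
  · have : c = k := le_antisymm (h ▸ Finset.mem_Iic.1 hc) hkc
    exact this ▸ hce

theorem toLex_le_of_sum_le {n : ℕ} {d e : Fin n →₀ ℕ} (i : Fin n)
    (hle : ∀ c < i, d c ≤ e c) (hd : ∑ c, d c ≤ ∑ c, e c) (he : ∀ c, i < c → e c = 0) :
    toLex d ≤ toLex e := by
  rcases eq_or_ne d e with rfl | hne
  · exact le_rfl
  have hE : ∑ c, e c = ∑ c ∈ Finset.Iic i, e c :=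
    (Finset.sum_subset (Finset.subset_univ _) fun c _ hc => he c (by simpa using hc)).symm
  have hD : ∑ c ∈ Finset.Iic i, d c ≤ ∑ c, d c :=
    Finset.sum_le_sum_of_subset (Finset.subset_univ _)
  rcases (hD.trans (hd.trans_eq hE)).lt_or_eq with h | h
  · exact (toLex_lt_of_sum_lt i hle h).le
  · by_contra hlt
    push Not at hlt
    refine hne (Finsupp.ext fun c => ?_)
    have heq : ∀ c ≤ i, d c = e c := by
      intro c hc
      obtain ⟨k, hk, hkk⟩ := Finsupp.Lex.lt_iff.1 hlt
      have hk' : ∀ j < k, e j = d j := hk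
      have hkk' : e k < d k := hkk
      rcases lt_trichotomy k i with hki | rfl | hki
      · exact absurd (hle k hki) (by omega)
      · exfalso
        refine absurd h (ne_of_gt ?_)
        refine Finset.sum_lt_sum (fun j hj => ?_) ⟨k, by simp, hkk'⟩
        rcases (Finset.mem_Iic.1 hj).lt_or_eq with hj | rfl
        · exact (hk' j hj).le
        · exact hkk'.le
      · exact (hk' c (hc.trans_lt hki)).symm
    by_cases hc : c ≤ i
    · exact heq c hc
    · have hsum : ∑ c, d c = ∑ c ∈ Finset.Iic i, d c := by omega
      have hz : d c = 0 := by
        have h2 := Finset.sum_add_sum_compl (Finset.Iic i) (fun c => d c)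
        have h3 : ∑ c ∈ (Finset.Iic i)ᶜ, d c = 0 := by omega
        exact Finset.sum_eq_zero_iff.1 h3 c (by simpa using hc)
      rw [hz, he c (not_le.1 hc)]

theorem coeff_prod_of_toLex_le {n : ℕ} {R ι : Type*} [CommRing R]
    (s : Finset ι) (f : ι → MvPolynomial (Fin n) R) (e : ι → Fin n →₀ ℕ)
    (h : ∀ i ∈ s, ∀ d ∈ (f i).support, toLex d ≤ toLex (e i)) :
    (∏ i ∈ s, f i).coeff (∑ i ∈ s, e i) = ∏ i ∈ s, (f i).coeff (e i) := by
  classical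
  induction s using Finset.induction_on with
  | empty => simp
  | insert a s ha ih =>
    rw [Finset.prod_insert ha, Finset.sum_insert ha, Finset.prod_insert ha,
      ← ih fun i hi => h i (by simp [hi])]
    refine (MonomialOrder.lex (σ := Fin n)).coeff_mul_of_add_of_degree_le ?_ ?_
    · refine MonomialOrder.degree_le_iff.2 fun d hd => ?_
      exact h a (by simp) d hd
    · refine MonomialOrder.degree_le_iff.2 fun d hd => ?_
      obtain ⟨m, hm, rfl⟩ := exists_sum_of_mem_support_prod s f hd
      rw [map_sum, map_sum]
      exact Finset.sum_le_sum fun i hi => h i (by simp [hi]) _ (hm i hi)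

/-! ### The polynomials `B p q` -/

theorem coeff_comp_X_add_one_sub (f : Polynomial ℝ) {n : ℕ} (hf : f.natDegree ≤ n + 1) :
    (f.comp (Polynomial.X + 1) - f).coeff n = (n + 1) * f.coeff (n + 1) := by
  have h1 : f.comp (Polynomial.X + 1) = Polynomial.taylor 1 f := by
    simp [Polynomial.taylor_apply]
  have h2 : (Polynomial.hasseDeriv n f).natDegree < 2 := by
    have := Polynomial.natDegree_hasseDeriv_le f n
    omega
  rw [Polynomial.coeff_sub, h1, Polynomial.taylor_coeff, Polynomial.eval_eq_sum_range' h2]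
  simp [Finset.sum_range_succ, Polynomial.hasseDeriv_coeff, add_comm 1 n]

theorem natDegree_le_comp_X_add_one_sub (f : Polynomial ℝ) :
    f.natDegree ≤ (f.comp (Polynomial.X + 1) - f).natDegree + 1 := by
  rcases Nat.eq_zero_or_pos f.natDegree with h | h
  · omega
  obtain ⟨n, hn⟩ : ∃ n, f.natDegree = n + 1 := ⟨f.natDegree - 1, by omega⟩
  have h2 : (f.comp (Polynomial.X + 1) - f).coeff n ≠ 0 := by
    rw [coeff_comp_X_add_one_sub f hn.le, ← hn]
    refine mul_ne_zero (by positivity) ?_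
    rw [Polynomial.coeff_natDegree, Polynomial.leadingCoeff_ne_zero]
    rintro rfl
    simp at hn
  have := Polynomial.le_natDegree_of_ne_zero h2
  omega

theorem natDegree_two_mul_X_add_one_mul {f : Polynomial ℝ} (hf : f ≠ 0) :
    ((2 * Polynomial.X + 1) * f).natDegree = f.natDegree + 1 := by
  have h : (2 * Polynomial.X + 1 : Polynomial ℝ) = Polynomial.C 2 * Polynomial.X + Polynomial.C 1 := by
    rw [Polynomial.C_1, ← Polynomial.C_ofNat]
  have h1 : (2 * Polynomial.X + 1 : Polynomial ℝ).natDegree = 1 := by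
    rw [h]
    exact Polynomial.natDegree_linear two_ne_zero
  have h0 : (2 * Polynomial.X + 1 : Polynomial ℝ) ≠ 0 := by
    intro h0
    simp [h0] at h1
  rw [Polynomial.natDegree_mul h0 hf, h1, add_comm]

theorem BProp.natDegree_le {B : ℤ → ℕ → Polynomial ℝ} (hB : BProp B) {p : ℤ} {q : ℕ}
    (hp : -1 ≤ p) (hpq : ¬(p = -1 ∧ q = 0)) :
    (B p q).natDegree ≤ (p + 2 * q).toNat := by
  have h1 := natDegree_le_comp_X_add_one_sub (B p q)
  rcases hp.eq_or_lt with rfl | hp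
  · have hq : 1 ≤ q := by
      by_contra h
      exact hpq ⟨rfl, by omega⟩
    rw [hB.2.2 q hq] at h1
    have h2 : (-((-Polynomial.X) * (Polynomial.X + 1) : Polynomial ℝ) ^ (q - 1)).natDegree
        ≤ (q - 1) * 2 := by
      compute_degree
    omega
  · lift p to ℕ using by omega
    by_cases h0 : (B p q).comp (Polynomial.X + 1) - B p q = 0
    · rw [h0] at h1
      by_contra hlt
      have h3 : (B p q).natDegree = 1 := by
        simp at h1
        omega
      have h4 := coeff_comp_X_add_one_sub (B p q) (n := 0) h3.le
      rw [h0] at h4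
      have h5 : (B p q).coeff (0 + 1) ≠ 0 := by
        rw [zero_add, ← h3, Polynomial.coeff_natDegree, Polynomial.leadingCoeff_ne_zero]
        intro h
        simp [h] at h3
      simp at h4
      exact h5 h4.symm
    · have h2 := natDegree_two_mul_X_add_one_mul h0
      rw [hB.2.1 p q] at h2
      have h3 : (((Polynomial.X + 1) ^ p - (-Polynomial.X) ^ p)
            * (Polynomial.X + 1) ^ q * (-Polynomial.X) ^ q : Polynomial ℝ).natDegree
          ≤ p + q + q := by
        refine Polynomial.natDegree_mul_le_of_le (Polynomial.natDegree_mul_le_of_le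
          ((Polynomial.natDegree_sub_le _ _).trans (max_le ?_ ?_)) ?_) ?_
        all_goals
          compute_degree
      omega

theorem BProp.coeff_even {B : ℤ → ℕ → Polynomial ℝ} (hB : BProp B) {p : ℤ} {q : ℕ}
    (hp : -1 ≤ p) (hpq : ¬(p = -1 ∧ q = 0)) {n : ℕ} (hn : Even n) : (B p q).coeff n = 0 := by
  have h := congrArg (fun f => Polynomial.coeff f n) (hB.1 p q hp hpq)
  have hX : (-Polynomial.X : Polynomial ℝ) = Polynomial.C (-1) * Polynomial.X := by simp
  simp only [hX, Polynomial.comp_C_mul_X_coeff, Polynomial.coeff_neg, hn.neg_one_pow] at h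
  linarith

theorem BProp.coeff_odd {B : ℤ → ℕ → Polynomial ℝ} (hB : BProp B) {r : ℕ} (hr : Odd r) :
    (B r 0).coeff r = (r : ℝ)⁻¹ := by
  obtain ⟨n, rfl⟩ : ∃ n, r = n + 1 := ⟨r - 1, by have := hr.pos; omega⟩
  have hd : (B ((n + 1 : ℕ) : ℤ) 0).natDegree ≤ n + 1 := by
    have := hB.natDegree_le (p := ((n + 1 : ℕ) : ℤ)) (q := 0) (by omega) (by omega)
    omega
  have h := congrArg (fun f => Polynomial.coeff f (n + 1)) (hB.2.1 (n + 1) 0)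
  have e : ∀ f : Polynomial ℝ, (2 * Polynomial.X + 1) * f
      = Polynomial.C 2 * (Polynomial.X * f) + f := by
    intro f
    rw [← Polynomial.C_ofNat]
    ring
  simp only [e, Polynomial.coeff_add, Polynomial.coeff_C_mul, Polynomial.coeff_X_mul, hr.neg_pow,
    pow_zero, mul_one, sub_neg_eq_add] at h
  rw [coeff_comp_X_add_one_sub _ hd, coeff_comp_X_add_one_sub _ (hd.trans (by omega)),
    Polynomial.coeff_eq_zero_of_natDegree_lt (n := n + 1 + 1) (by omega),
    Polynomial.coeff_X_add_one_pow, Polynomial.coeff_X_pow_self] at h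
  simp only [Nat.choose_self] at h
  have h0 : ((n + 1 : ℕ) : ℝ) ≠ 0 := by positivity
  field_simp
  push_cast at h ⊢
  linarith

/-! ### A polynomial model of the entries `x_i * φ_j(x_i)` -/

/-- The variable `x_{i+1}`. -/
def xVar (ℓ : ℕ) (i : Fin ℓ) : SS ℓ := X i.castSucc

/-- The variable `z`. -/
def zVar (ℓ : ℕ) : SS ℓ := X (Fin.last ℓ)

/-- The polynomial `x_a * ar B_{p,q}(x_a, z)`. -/
def arBPoly (B : ℤ → ℕ → Polynomial ℝ) (ℓ : ℕ) (p : ℤ) (q : ℕ) (a : Fin ℓ) : SS ℓ :=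
  if p = -1 ∧ q = 0 then -1
  else ∑ m ∈ range ((p + 2 * (q : ℤ)).toNat + 1),
    C ((B p q).coeff m) * (xVar ℓ a ^ (m + 1) * zVar ℓ ^ ((p + 2 * (q : ℤ)).toNat - m))

/-- The monomial factor `∏K₁ · (∏K₂)² · (-z)^|K₁|`. -/
def subsetFactor (ℓ : ℕ) (K1 K2 : Finset (Fin ℓ)) : SS ℓ :=
  (∏ a ∈ K1, xVar ℓ a) * (∏ a ∈ K2, xVar ℓ a) ^ 2 * (-zVar ℓ) ^ K1.card

/-- The upper index `k` occurring in the summand of `φ_{j+1}` with parameters `n₁, n₂`. -/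
def upperIndex (ℓ j n1 n2 : ℕ) : ℤ :=
  (2 - (n1 : ℤ)) + 2 * ((ℓ : ℤ) - (j : ℤ) - 2 - (n2 : ℤ)) - 1

/-- The indices of the variables in `J₂`. -/
def upperVars (ℓ : ℕ) (j : Fin ℓ) : Finset (Fin ℓ) :=
  univ.filter (fun a : Fin ℓ => (j : ℕ) + 1 < (a : ℕ))

/-- The summand of `x_i * φ_{j+1}(x_i)` with parameters `n₁, n₂` and lower index `q`. -/
def symSummand (B : ℤ → ℕ → Polynomial ℝ) (ℓ : ℕ) (j : Fin ℓ) (h : (j : ℕ) + 1 < ℓ)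
    (i : Fin ℓ) (q n1 n2 : ℕ) : SS ℓ :=
  (-1) ^ (n1 + n2) * esymVal ({j, ⟨(j : ℕ) + 1, h⟩} : Finset (Fin ℓ)) (xVar ℓ) n1 *
    esymVal (upperVars ℓ j) (fun a => xVar ℓ a ^ 2) n2 *
    arBPoly B ℓ (upperIndex ℓ j n1 n2) q i

/-- The polynomial `x_i * φ_{j+1}(x_i)`. -/
def phiPoly (B : ℤ → ℕ → Polynomial ℝ) (ℓ : ℕ) (j i : Fin ℓ) : SS ℓ :=
  if h : (j : ℕ) + 1 < ℓ then
    ∑ K1 ∈ (Jset ℓ j).powerset, ∑ K2 ∈ ((Jset ℓ j) \ K1).powerset,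
      ∑ n1 ∈ range 3, ∑ n2 ∈ range (ℓ - (j : ℕ) - 1),
        (xVar ℓ j - xVar ℓ ⟨(j : ℕ) + 1, h⟩ - zVar ℓ) * subsetFactor ℓ K1 K2 *
          symSummand B ℓ j h i ((j : ℕ) - K1.card - K2.card) n1 n2
  else
    ∑ K1 ∈ (Jset ℓ j).powerset, ∑ K2 ∈ ((Jset ℓ j) \ K1).powerset,
      -xVar ℓ j * subsetFactor ℓ K1 K2 * arBPoly B ℓ (-1) ((j : ℕ) - K1.card - K2.card) i

section Model

variable {B : ℤ → ℕ → Polynomial ℝ} {ℓ : ℕ}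

theorem algebraMap_xVar (i : Fin ℓ) : algebraMap (SS ℓ) (KK ℓ) (xVar ℓ i) = xx ℓ i := rfl

theorem algebraMap_zVar : algebraMap (SS ℓ) (KK ℓ) (zVar ℓ) = zz ℓ := rfl

theorem xx_ne_zero (i : Fin ℓ) : xx ℓ i ≠ 0 := by
  rw [← algebraMap_xVar, Ne, FaithfulSMul.algebraMap_eq_zero_iff]
  exact X_ne_zero _

theorem zz_ne_zero : zz ℓ ≠ 0 := by
  rw [← algebraMap_zVar, Ne, FaithfulSMul.algebraMap_eq_zero_iff]
  exact X_ne_zero _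

theorem algebraMap_esymVal {α : Type*} (s : Finset α) (f : α → SS ℓ) (n : ℕ) :
    algebraMap (SS ℓ) (KK ℓ) (esymVal s f n)
      = esymVal s (fun a => algebraMap (SS ℓ) (KK ℓ) (f a)) n := by
  simp [esymVal, map_sum, map_prod]

theorem algebraMap_arBPoly (hB : BProp B) {p : ℤ} (hp : -1 ≤ p) (q : ℕ) (a : Fin ℓ) :
    algebraMap (SS ℓ) (KK ℓ) (arBPoly B ℓ p q a) = xx ℓ a * arB B ℓ p q (xx ℓ a) := by
  rw [arBPoly, arB]
  split_ifs with h
  · rw [map_neg, map_one, mul_neg, mul_inv_cancel₀ (xx_ne_zero a)]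
  · have hN : p + 2 * (q : ℤ) = ((p + 2 * (q : ℤ)).toNat : ℤ) := by omega
    have hd := hB.natDegree_le hp h
    set N := (p + 2 * (q : ℤ)).toNat
    rw [hN, zpow_natCast, Polynomial.eval₂_eq_sum_range' _ (Nat.lt_succ_of_le hd), map_sum,
      mul_sum, mul_sum]
    refine sum_congr rfl fun m hm => ?_
    have hm : m ≤ N := Nat.lt_succ_iff.1 (mem_range.1 hm)
    obtain ⟨k, hk⟩ := Nat.exists_eq_add_of_le hm
    have hz : zz ℓ ≠ 0 := zz_ne_zero
    rw [map_mul, map_mul, map_pow, map_pow, algebraMap_xVar, algebraMap_zVar, hk,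
      Nat.add_sub_cancel_left, RingHom.comp_apply, div_pow, pow_add, pow_succ]
    field_simp
    ring

theorem algebraMap_phiPoly (hB : BProp B) (j i : Fin ℓ) :
    algebraMap (SS ℓ) (KK ℓ) (phiPoly B ℓ j i) = xx ℓ i * phi B ℓ j i := by
  rw [phiPoly, phi]
  split_ifs with h
  · simp only [map_sum, mul_sum]
    refine sum_congr rfl fun K1 _ => sum_congr rfl fun K2 _ => sum_congr rfl fun n1 hn1 =>
      sum_congr rfl fun n2 hn2 => ?_
    rw [mem_range] at hn1 hn2
    rw [symSummand]
    simp only [map_mul]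
    rw [algebraMap_arBPoly hB (by rw [upperIndex]; omega), algebraMap_esymVal, algebraMap_esymVal]
    simp only [map_sub, map_mul, map_pow, map_prod, map_neg, map_one, subsetFactor,
      algebraMap_xVar, algebraMap_zVar, upperIndex, upperVars]
    ring
  · simp only [map_sum, mul_sum]
    refine sum_congr rfl fun K1 _ => sum_congr rfl fun K2 _ => ?_
    rw [map_mul, algebraMap_arBPoly hB le_rfl]
    simp only [map_mul, map_pow, map_prod, map_neg, subsetFactor,
      algebraMap_xVar, algebraMap_zVar]
    ring

/-! ### Weight bounds for the model -/

variable {w : Fin (ℓ + 1) → ℕ}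

theorem weightLE_xVar (i : Fin ℓ) : WeightLE w (xVar ℓ i) (w i.castSucc) :=
  WeightLE.var _ le_rfl

theorem weightLE_zVar : WeightLE w (zVar ℓ) (w (Fin.last ℓ)) :=
  WeightLE.var _ le_rfl

theorem weightLE_arBPoly {p : ℤ} (hp : -1 ≤ p) (q : ℕ) (a : Fin ℓ) {M : ℕ}
    (ha : w a.castSucc ≤ M) (hz : w (Fin.last ℓ) ≤ M) :
    WeightLE w (arBPoly B ℓ p q a) ((p + 2 * (q : ℤ) + 1).toNat * M) := by
  rw [arBPoly]
  split_ifs with h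
  · exact WeightLE.one.neg
  · refine WeightLE.sum fun m hm => ?_
    have hN : (p + 2 * (q : ℤ) + 1).toNat = (p + 2 * (q : ℤ)).toNat + 1 := by omega
    rw [hN]
    set N := (p + 2 * (q : ℤ)).toNat
    rw [mem_range] at hm
    refine ((WeightLE.const (n := 0) _).mul (((weightLE_xVar a).pow _).mul
      (weightLE_zVar.pow _))).mono ?_
    calc 0 + ((m + 1) * w a.castSucc + (N - m) * w (Fin.last ℓ))
        ≤ (m + 1) * M + (N - m) * M := by
          rw [zero_add]
          gcongr
      _ = (m + 1 + (N - m)) * M := by ring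
      _ = (N + 1) * M := by congr 1; omega

theorem weightLE_subsetFactor (K1 K2 : Finset (Fin ℓ)) :
    WeightLE w (subsetFactor ℓ K1 K2)
      (∑ a ∈ K1, w a.castSucc + 2 * ∑ a ∈ K2, w a.castSucc + K1.card * w (Fin.last ℓ)) :=
  ((WeightLE.prod fun i _ => weightLE_xVar i).mul
    ((WeightLE.prod fun i _ => weightLE_xVar i).pow 2)).mul (weightLE_zVar.neg.pow _)

theorem card_Jset (j : Fin ℓ) : (Jset ℓ j).card = j := by
  rw [← Fin.card_Iio j]
  congr 1
  ext a
  simp [Jset]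

theorem card_add_card_le {j : Fin ℓ} {K1 K2 : Finset (Fin ℓ)} (h1 : K1 ∈ (Jset ℓ j).powerset)
    (h2 : K2 ∈ (Jset ℓ j \ K1).powerset) : K1.card + K2.card ≤ j := by
  rw [mem_powerset] at h1 h2
  have h := card_le_card h2
  have h' := card_le_card h1
  rw [card_sdiff_of_subset h1] at h
  rw [card_Jset] at h h'
  omega

theorem sum_castSucc_le_card (hw : ∀ v, w v ≤ 1) (K : Finset (Fin ℓ)) :
    ∑ a ∈ K, w a.castSucc ≤ K.card := by
  simpa using sum_le_card_nsmul K (fun a => w a.castSucc) 1 fun a _ => hw _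

theorem neg_one_pow_weightLE (k : ℕ) : WeightLE w ((-1 : SS ℓ) ^ k) 0 :=
  ((WeightLE.one (n := 0)).neg.pow k).mono (by simp)

/-- If all weights are at most one and the linear factor of `φ_{j+1}` has weight at most `r`, then
`x_i * φ_{j+1}(x_i)` has weight at most `2ℓ - 2 + r`. -/
theorem weightLE_phiPoly (hw : ∀ v, w v ≤ 1) (j i : Fin ℓ) {r : ℕ} (hj : w j.castSucc ≤ r)
    (hj' : ∀ h : (j : ℕ) + 1 < ℓ, w (Fin.castSucc ⟨(j : ℕ) + 1, h⟩) ≤ r ∧ w (Fin.last ℓ) ≤ r) :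
    WeightLE w (phiPoly B ℓ j i) (2 * ℓ - 2 + r) := by
  have hfac (K1 K2 : Finset (Fin ℓ)) :
      WeightLE w (subsetFactor ℓ K1 K2) (2 * (K1.card + K2.card)) := by
    refine (weightLE_subsetFactor K1 K2).mono ?_
    have h1 := sum_castSucc_le_card hw K1
    have h2 := sum_castSucc_le_card hw K2
    have h3 := Nat.mul_le_mul_left K1.card (hw (Fin.last ℓ))
    omega
  rw [phiPoly]
  split_ifs with h
  · refine WeightLE.sum fun K1 h1 => WeightLE.sum fun K2 h2 => WeightLE.sum fun n1 hn1 =>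
      WeightLE.sum fun n2 hn2 => ?_
    have hc := card_add_card_le h1 h2
    rw [mem_range] at hn1 hn2
    have hpre : WeightLE w (xVar ℓ j - xVar ℓ ⟨(j : ℕ) + 1, h⟩ - zVar ℓ) r :=
      (((weightLE_xVar _).mono hj).sub ((weightLE_xVar _).mono (hj' h).1)).sub
        (weightLE_zVar.mono (hj' h).2)
    have hes1 : WeightLE w
        (esymVal ({j, ⟨(j : ℕ) + 1, h⟩} : Finset (Fin ℓ)) (xVar ℓ) n1) n1 :=
      WeightLE.esymVal (fun a _ => weightLE_xVar a) fun t _ ht =>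
        ht ▸ sum_castSucc_le_card hw t
    have hes2 : WeightLE w (esymVal (upperVars ℓ j) (fun a => xVar ℓ a ^ 2) n2) (2 * n2) := by
      refine WeightLE.esymVal (fun a _ => (weightLE_xVar a).pow 2) fun t _ ht => ?_
      rw [← mul_sum]
      exact Nat.mul_le_mul_left 2 (ht ▸ sum_castSucc_le_card hw t)
    have hk : -1 ≤ upperIndex ℓ j n1 n2 := by rw [upperIndex]; omega
    refine ((hpre.mul (hfac K1 K2)).mul ((((neg_one_pow_weightLE _).mul hes1).mul hes2).mul
      (weightLE_arBPoly hk _ i (hw _) (hw _)))).mono ?_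
    rw [upperIndex]
    omega
  · refine WeightLE.sum fun K1 h1 => WeightLE.sum fun K2 h2 => ?_
    have hc := card_add_card_le h1 h2
    refine ((((weightLE_xVar j).mono hj).neg.mul (hfac K1 K2)).mul
      (weightLE_arBPoly le_rfl _ i (hw _) (hw _))).mono ?_
    have := j.isLt
    omega

theorem sum_single_castSucc (c : Fin ℓ) (K : Finset (Fin ℓ)) :
    ∑ a ∈ K, (Pi.single c.castSucc 1 : Fin (ℓ + 1) → ℕ) a.castSucc = if c ∈ K then 1 else 0 := by
  simp [Pi.single_apply, Finset.sum_ite_eq']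

theorem single_castSucc_last (c : Fin ℓ) :
    (Pi.single c.castSucc 1 : Fin (ℓ + 1) → ℕ) (Fin.last ℓ) = 0 := by
  simp [(Fin.castSucc_lt_last c).ne']

theorem single_castSucc (c a : Fin ℓ) :
    (Pi.single c.castSucc 1 : Fin (ℓ + 1) → ℕ) a.castSucc = if a = c then 1 else 0 := by
  simp [Pi.single_apply]

/-- The degree of the subset factor in `x_c`. -/
theorem weightLE_single_subsetFactor (c : Fin ℓ) (K1 K2 : Finset (Fin ℓ)) :
    WeightLE (Pi.single c.castSucc 1) (subsetFactor ℓ K1 K2)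
      ((if c ∈ K1 then 1 else 0) + 2 * if c ∈ K2 then 1 else 0) := by
  refine (weightLE_subsetFactor K1 K2).mono ?_
  rw [sum_single_castSucc, sum_single_castSucc, single_castSucc_last]
  omega

theorem weightLE_single_linear {j : Fin ℓ} (h : (j : ℕ) + 1 < ℓ) (c : Fin ℓ) (hc : c ≤ j) :
    WeightLE (Pi.single c.castSucc 1) (xVar ℓ j - xVar ℓ ⟨(j : ℕ) + 1, h⟩ - zVar ℓ)
      (if j = c then 1 else 0) := by
  refine (WeightLE.sub ?_ ?_).sub ?_
  · exact (weightLE_xVar j).mono (single_castSucc c j).le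
  · refine (weightLE_xVar _).mono ?_
    rw [single_castSucc, if_neg]
    · exact Nat.zero_le _
    · rintro rfl
      exact absurd (Fin.le_def.1 hc) (by simp)
  · exact weightLE_zVar.mono ((single_castSucc_last c).trans_le (Nat.zero_le _))

theorem weightLE_single_esym_pair {j : Fin ℓ} (h : (j : ℕ) + 1 < ℓ) (c : Fin ℓ) (hc : c ≤ j)
    (n1 : ℕ) :
    WeightLE (Pi.single c.castSucc 1)
      (esymVal ({j, ⟨(j : ℕ) + 1, h⟩} : Finset (Fin ℓ)) (xVar ℓ) n1)
      (if j = c ∧ n1 ≠ 0 then 1 else 0) := by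
  refine WeightLE.esymVal (fun a _ => weightLE_xVar a) fun t ht hn => ?_
  rw [sum_single_castSucc]
  split_ifs with h1 h2 h2
  · exact le_rfl
  · exfalso
    refine h2 ⟨?_, fun h0 => ?_⟩
    · have := ht h1
      simp only [mem_insert, mem_singleton] at this
      rcases this with rfl | rfl
      · rfl
      · exact absurd (Fin.le_def.1 hc) (by simp)
    · rw [h0, card_eq_zero] at hn
      simp [hn] at h1
  · exact Nat.zero_le _
  · exact le_rfl

theorem weightLE_single_esym_upper {j : Fin ℓ} (c : Fin ℓ) (hc : c ≤ j) (n2 : ℕ) :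
    WeightLE (Pi.single c.castSucc 1) (esymVal (upperVars ℓ j) (fun a => xVar ℓ a ^ 2) n2) 0 := by
  refine WeightLE.esymVal (b := fun _ => 0) (fun a ha => ?_) (by simp)
  refine ((weightLE_xVar a).pow 2).mono ?_
  rw [single_castSucc, if_neg]
  rintro rfl
  simp only [upperVars, mem_filter, mem_univ, true_and] at ha
  exact absurd (Fin.le_def.1 hc) (by omega)

/-- The degree in `x_c` of the part of a summand depending on `n₁, n₂`, for `c ≤ j`, `c ≠ i`. -/
theorem weightLE_single_symSummand {j : Fin ℓ} (h : (j : ℕ) + 1 < ℓ) {i c : Fin ℓ} (hc : c ≤ j)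
    (hci : i ≠ c) (q : ℕ) {n1 n2 : ℕ} (hn1 : n1 < 3) (hn2 : n2 < ℓ - (j : ℕ) - 1) :
    WeightLE (Pi.single c.castSucc 1) (symSummand B ℓ j h i q n1 n2) (if j = c then 1 else 0) := by
  have hk : -1 ≤ upperIndex ℓ j n1 n2 := by rw [upperIndex]; omega
  refine ((((neg_one_pow_weightLE _).mul (weightLE_single_esym_pair h c hc n1)).mul
    (weightLE_single_esym_upper c hc n2)).mul (weightLE_arBPoly hk _ i (M := 0) ?_ ?_)).mono ?_
  · rw [single_castSucc, if_neg hci]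
  · rw [single_castSucc_last]
  · by_cases hj : j = c <;> simp [hj]
    split_ifs <;> simp

/-- The degree of `x_i * φ_{j+1}(x_i)` in `x_c` is at most two for `c < i`, `c ≤ j`. -/
theorem weightLE_single_phiPoly {j i c : Fin ℓ} (hci : c < i) (hcj : c ≤ j) :
    WeightLE (Pi.single c.castSucc 1) (phiPoly B ℓ j i) 2 := by
  rw [phiPoly]
  split_ifs with h
  · refine WeightLE.sum fun K1 h1 => WeightLE.sum fun K2 h2 => WeightLE.sum fun n1 hn1 =>
      WeightLE.sum fun n2 hn2 => ?_
    rw [mem_range] at hn1 hn2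
    refine (((weightLE_single_linear h c hcj).mul (weightLE_single_subsetFactor c K1 K2)).mul
      (weightLE_single_symSummand h hcj hci.ne' _ hn1 hn2)).mono ?_
    rw [mem_powerset] at h1 h2
    by_cases hj : j = c
    · subst hj
      have hJ : j ∉ Jset ℓ j := by simp [Jset]
      have hK1 : j ∉ K1 := fun h => hJ (h1 h)
      have hK2 : j ∉ K2 := fun h => hJ (mem_sdiff.1 (h2 h)).1
      simp [hK1, hK2]
    · have : ¬ (c ∈ K1 ∧ c ∈ K2) := fun h => (mem_sdiff.1 (h2 h.2)).2 h.1
      simp only [hj, if_false]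
      split_ifs <;> simp_all
  · refine WeightLE.sum fun K1 h1 => WeightLE.sum fun K2 h2 => ?_
    have hjc : j ≠ c := by
      rintro rfl
      have := Fin.lt_def.1 hci
      omega
    refine (((weightLE_xVar j).neg.mul (weightLE_single_subsetFactor c K1 K2)).mul
      (weightLE_arBPoly le_rfl _ i (M := 0) ?_ ?_)).mono ?_
    · rw [single_castSucc, if_neg hci.ne']
    · rw [single_castSucc_last]
    · rw [mem_powerset] at h1 h2
      have : ¬ (c ∈ K1 ∧ c ∈ K2) := fun h => (mem_sdiff.1 (h2 h.2)).2 h.1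
      rw [single_castSucc, if_neg hjc]
      split_ifs <;> simp_all

/-! ### The diagonal entries -/

/-- The leading exponent of the diagonal entry `x_a * φ_a(x_a)`. -/
def diagExp (ℓ : ℕ) (a : Fin ℓ) : Fin (ℓ + 1) →₀ ℕ :=
  Finsupp.equivFunOnFinite.symm fun c =>
    if (c : ℕ) < a then 2 else if (c : ℕ) = a then 2 * (ℓ - 1 - a) + 1 else 0

theorem diagExp_of_lt {a c : Fin ℓ} (h : c < a) : diagExp ℓ a c.castSucc = 2 := by
  simp [diagExp, Fin.lt_def.1 h]

theorem diagExp_self (a : Fin ℓ) : diagExp ℓ a a.castSucc = 2 * (ℓ - 1 - a) + 1 := by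
  simp [diagExp]

theorem diagExp_of_gt {a : Fin ℓ} {c : Fin (ℓ + 1)} (h : a.castSucc < c) : diagExp ℓ a c = 0 := by
  have h' : (a : ℕ) < c := h
  simp only [diagExp, Finsupp.equivFunOnFinite_symm_apply_apply]
  rw [if_neg (by omega), if_neg (by omega)]

theorem diagExp_castSucc (a c : Fin ℓ) : diagExp ℓ a c.castSucc
    = (if c ∈ Jset ℓ a then 2 else 0) + if c = a then 2 * (ℓ - 1 - a) + 1 else 0 := by
  simp only [diagExp, Finsupp.equivFunOnFinite_symm_apply_apply, Jset, mem_filter, mem_univ,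
    true_and, Fin.lt_def, Fin.ext_iff, Fin.val_castSucc]
  split_ifs <;> omega

theorem sum_diagExp (a : Fin ℓ) : ∑ c, diagExp ℓ a c = 2 * ℓ - 1 := by
  rw [Fin.sum_univ_castSucc, diagExp_of_gt (Fin.castSucc_lt_last a)]
  simp only [diagExp_castSucc, sum_add_distrib, sum_ite_eq', mem_univ, if_true]
  rw [sum_ite_mem, univ_inter, sum_const, card_Jset]
  have := a.isLt
  simp only [smul_eq_mul]
  omega

theorem sum_Iic_diagExp (a : Fin ℓ) : ∑ c ∈ Iic a.castSucc, diagExp ℓ a c = 2 * ℓ - 1 := by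
  rw [← sum_diagExp a]
  exact sum_subset (subset_univ _) fun c _ hc => diagExp_of_gt (by simpa using hc)

theorem sum_diagExp_eq : ∑ a, diagExp ℓ a = expoD ℓ + ∑ a : Fin ℓ, Finsupp.single a.castSucc 1 := by
  ext v
  rw [Finsupp.add_apply, Finsupp.finsetSum_apply, Finsupp.finsetSum_apply]
  refine Fin.lastCases ?_ (fun c => ?_) v
  · rw [sum_eq_zero fun a _ => diagExp_of_gt (Fin.castSucc_lt_last a), sum_eq_zero fun a _ => ?_]
    · simp only [expoD, Finsupp.equivFunOnFinite_symm_apply_apply, Fin.val_last]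
      omega
    · rw [Finsupp.single_apply, if_neg (Fin.castSucc_lt_last a).ne]
  · simp only [diagExp_castSucc, sum_add_distrib, sum_ite_eq, mem_univ, if_true]
    have h1 : ∑ a : Fin ℓ, (if c ∈ Jset ℓ a then 2 else 0) = 2 * (ℓ - 1 - c) := by
      rw [← sum_filter, sum_const, smul_eq_mul, mul_comm]
      congr 1
      rw [← Fin.card_Ioi c]
      congr 1
      ext a
      simp [Jset]
    have h2 : ∑ a : Fin ℓ, (Finsupp.single a.castSucc 1 : Fin (ℓ + 1) →₀ ℕ) c.castSucc = 1 := by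
      simp [Finsupp.single_apply]
    rw [h1, h2]
    simp only [expoD, Finsupp.equivFunOnFinite_symm_apply_apply, Fin.val_castSucc]
    omega

theorem monomial_diagExp (a : Fin ℓ) :
    monomial (diagExp ℓ a) (1 : ℝ)
      = subsetFactor ℓ ∅ (Jset ℓ a) * xVar ℓ a ^ (2 * (ℓ - 1 - (a : ℕ)) + 1) := by
  rw [monomial_eq, Finsupp.prod_fintype _ _ (by simp), Fin.prod_univ_castSucc,
    diagExp_of_gt (Fin.castSucc_lt_last a)]
  simp only [diagExp_castSucc, pow_add, prod_mul_distrib, subsetFactor]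
  rw [← prod_pow]
  simp only [pow_ite, pow_zero, prod_ite_mem, univ_inter, prod_ite_eq', mem_univ, if_true]
  simp [xVar, pow_succ]

/-- A summand whose set `K₂` is not all of `J` does not contribute to the diagonal coefficient. -/
theorem coeff_diagExp_eq_zero {a c : Fin ℓ} (hc : c < a) {K1 K2 : Finset (Fin ℓ)} (hK : c ∉ K2)
    {f g : SS ℓ} (hf : WeightLE (Pi.single c.castSucc 1) f 0)
    (hg : WeightLE (Pi.single c.castSucc 1) g 0) :
    (f * subsetFactor ℓ K1 K2 * g).coeff (diagExp ℓ a) = 0 := by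
  refine ((hf.mul (weightLE_single_subsetFactor c K1 K2)).mul hg).coeff_eq_zero ?_
  rw [Finsupp.weight_single_one_apply, diagExp_of_lt hc, if_neg hK]
  split_ifs <;> simp

theorem sum_powerset_eq {R α : Type*} [AddCommMonoid R] [DecidableEq α] (J : Finset α)
    (F : Finset α → Finset α → R)
    (h : ∀ K1 K2, K1 ⊆ J → K2 ⊆ J \ K1 → ∀ c ∈ J, c ∉ K2 → F K1 K2 = 0) :
    ∑ K1 ∈ J.powerset, ∑ K2 ∈ (J \ K1).powerset, F K1 K2 = F ∅ J := by
  have key : ∀ K1 ∈ J.powerset, ∀ K2 ∈ (J \ K1).powerset, (K1 ≠ ∅ ∨ K2 ≠ J) → F K1 K2 = 0 := by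
    intro K1 h1 K2 h2 hne
    rw [mem_powerset] at h1 h2
    have hK2 : K2 ⊆ J := h2.trans sdiff_subset
    rcases hne with hne | hne
    · obtain ⟨c, hc⟩ := nonempty_iff_ne_empty.2 hne
      exact h K1 K2 h1 h2 c (h1 hc) fun hc' => (mem_sdiff.1 (h2 hc')).2 hc
    · obtain ⟨c, hc, hc'⟩ := exists_of_ssubset (hK2.ssubset_of_ne hne)
      exact h K1 K2 h1 h2 c hc hc'
  rw [sum_eq_single_of_mem ∅ (by simp), sum_eq_single_of_mem J (by simp)]
  · exact fun K2 h2 hne => key _ (by simp) _ h2 (Or.inr hne)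
  · exact fun K1 h1 hne => sum_eq_zero fun K2 h2 => key _ h1 _ h2 (Or.inl hne)

theorem coeff_phiPoly_last {a : Fin ℓ} (h : ¬ (a : ℕ) + 1 < ℓ) :
    (phiPoly B ℓ a a).coeff (diagExp ℓ a) = 1 := by
  simp only [phiPoly, dif_neg h, coeff_sum]
  rw [sum_powerset_eq]
  · rw [card_Jset, card_empty, Nat.sub_zero, Nat.sub_self, arBPoly, if_pos ⟨rfl, rfl⟩]
    have h1 : -xVar ℓ a * subsetFactor ℓ ∅ (Jset ℓ a) * -1 = monomial (diagExp ℓ a) 1 := by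
      rw [monomial_diagExp, show ℓ - 1 - (a : ℕ) = 0 by omega]
      ring
    rw [h1, coeff_monomial, if_pos rfl]
  · intro K1 K2 _ _ c hc hK
    have hca : c < a := by simpa [Jset] using hc
    refine coeff_diagExp_eq_zero hca hK ?_ ?_
    · exact (weightLE_xVar a).neg.mono (by rw [single_castSucc, if_neg hca.ne'])
    · refine (weightLE_arBPoly le_rfl _ a (M := 0) ?_ ?_).mono (by simp)
      · rw [single_castSucc, if_neg hca.ne']
      · rw [single_castSucc_last]

/-- For even upper index the degree of `x * ar B` in `x` drops by one. -/
theorem weightLE_arBPoly_even (hB : BProp B) {p : ℤ} (hp : 0 ≤ p) (hpe : Even p) (q : ℕ)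
    (a : Fin ℓ) :
    WeightLE (Pi.single a.castSucc 1) (arBPoly B ℓ p q a) (p + 2 * (q : ℤ)).toNat := by
  have hne : ¬ (p = -1 ∧ q = 0) := by omega
  rw [arBPoly, if_neg hne]
  have heven : Even (p + 2 * (q : ℤ)).toNat := by
    rw [← Int.even_coe_nat, Int.toNat_of_nonneg (by omega)]
    exact hpe.add (even_two_mul _)
  rw [sum_range_succ, hB.coeff_even (by omega) hne heven, C_0, zero_mul, add_zero]
  refine WeightLE.sum fun m hm => ?_
  rw [mem_range] at hm
  refine ((WeightLE.const (n := 0) _).mul (((weightLE_xVar a).pow _).mul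
    (weightLE_zVar.pow _))).mono ?_
  rw [single_castSucc, if_pos rfl, single_castSucc_last]
  omega

/-- The coefficient of the highest power of `x_a` in the main summand of `φ_a(x_a)`. -/
theorem coeff_main_summand (hB : BProp B) {a : Fin ℓ} (h : (a : ℕ) + 1 < ℓ) :
    ((xVar ℓ a - xVar ℓ ⟨(a : ℕ) + 1, h⟩ - zVar ℓ) * subsetFactor ℓ ∅ (Jset ℓ a) *
      symSummand B ℓ a h a 0 0 0).coeff (diagExp ℓ a) = (2 * ((ℓ - 2 - a : ℕ) : ℝ) + 1)⁻¹ := by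
  set N := 2 * (ℓ - 2 - (a : ℕ)) + 1 with hN
  have hk : upperIndex ℓ a 0 0 = (N : ℤ) := by
    rw [upperIndex]
    omega
  have hE : 2 * (ℓ - 1 - (a : ℕ)) + 1 = N + 2 := by omega
  have hN' : ((N : ℤ) + 2 * ((0 : ℕ) : ℤ)).toNat = N := by omega
  have harB : symSummand B ℓ a h a 0 0 0
      = ∑ m ∈ range N, C ((B N 0).coeff m) * (xVar ℓ a ^ (m + 1) * zVar ℓ ^ (N - m))
        + C (N : ℝ)⁻¹ * xVar ℓ a ^ (N + 1) := by
    rw [symSummand, hk, arBPoly, if_neg (by omega), hN', sum_range_succ,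
      hB.coeff_odd (r := N) (odd_two_mul_add_one _)]
    simp [esymVal]
  set r := ∑ m ∈ range N, C ((B N 0).coeff m) * (xVar ℓ a ^ (m + 1) * zVar ℓ ^ (N - m)) with hr
  have hr' : WeightLE (Pi.single a.castSucc 1) r N := by
    refine WeightLE.sum fun m hm => ?_
    rw [mem_range] at hm
    refine ((WeightLE.const (n := 0) _).mul (((weightLE_xVar a).pow _).mul
      (weightLE_zVar.pow _))).mono ?_
    rw [single_castSucc, if_pos rfl, single_castSucc_last]
    omega
  have hJ : a ∉ Jset ℓ a := by simp [Jset]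
  have hfac : WeightLE (Pi.single a.castSucc 1) (subsetFactor ℓ ∅ (Jset ℓ a)) 0 := by
    simpa [hJ] using weightLE_single_subsetFactor a ∅ (Jset ℓ a)
  have hlin : WeightLE (Pi.single a.castSucc 1)
      (xVar ℓ a - xVar ℓ ⟨(a : ℕ) + 1, h⟩ - zVar ℓ) 1 := by
    simpa using weightLE_single_linear h a le_rfl
  have htail : WeightLE (Pi.single a.castSucc 1) (-xVar ℓ ⟨(a : ℕ) + 1, h⟩ - zVar ℓ) 0 := by
    refine ((weightLE_xVar _).neg.mono ?_).sub (weightLE_zVar.mono ?_)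
    · rw [single_castSucc, if_neg]
      intro h'
      have := congrArg Fin.val h'
      simp at this
    · rw [single_castSucc_last]
  have hpow : WeightLE (Pi.single a.castSucc 1) (C (N : ℝ)⁻¹ * xVar ℓ a ^ (N + 1)) (N + 1) := by
    refine ((WeightLE.const (n := 0) _).mul ((weightLE_xVar a).pow _)).mono ?_
    rw [single_castSucc, if_pos rfl]
    omega
  have hw : Finsupp.weight (Pi.single a.castSucc 1) (diagExp ℓ a) = N + 2 := by
    rw [Finsupp.weight_single_one_apply, diagExp_self, hE]
  have hsplit : (xVar ℓ a - xVar ℓ ⟨(a : ℕ) + 1, h⟩ - zVar ℓ) * subsetFactor ℓ ∅ (Jset ℓ a) *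
      symSummand B ℓ a h a 0 0 0
      = C (N : ℝ)⁻¹ * monomial (diagExp ℓ a) 1
        + ((xVar ℓ a - xVar ℓ ⟨(a : ℕ) + 1, h⟩ - zVar ℓ) * subsetFactor ℓ ∅ (Jset ℓ a) * r
          + (-xVar ℓ ⟨(a : ℕ) + 1, h⟩ - zVar ℓ) * subsetFactor ℓ ∅ (Jset ℓ a) *
            (C (N : ℝ)⁻¹ * xVar ℓ a ^ (N + 1))) := by
    rw [harB, monomial_diagExp, hE]
    ring
  rw [hsplit, coeff_add, coeff_add, coeff_C_mul, coeff_monomial, if_pos rfl,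
    ((hlin.mul hfac).mul hr').coeff_eq_zero (by rw [hw]; omega),
    ((htail.mul hfac).mul hpow).coeff_eq_zero (by rw [hw]; omega), hN]
  push_cast
  ring

theorem coeff_phiPoly_of_lt (hB : BProp B) {a : Fin ℓ} (h : (a : ℕ) + 1 < ℓ) :
    (phiPoly B ℓ a a).coeff (diagExp ℓ a) = (2 * ((ℓ - 2 - a : ℕ) : ℝ) + 1)⁻¹ := by
  simp only [phiPoly, dif_pos h, coeff_sum]
  rw [sum_powerset_eq]
  · rw [card_Jset, card_empty, Nat.sub_zero, Nat.sub_self]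
    have hJ : a ∉ Jset ℓ a := by simp [Jset]
    have hz : ∀ n1 ∈ range 3, ∀ n2 ∈ range (ℓ - (a : ℕ) - 1), (n1 ≠ 0 ∨ n2 ≠ 0) →
        ((xVar ℓ a - xVar ℓ ⟨(a : ℕ) + 1, h⟩ - zVar ℓ) * subsetFactor ℓ ∅ (Jset ℓ a) *
          symSummand B ℓ a h a 0 n1 n2).coeff (diagExp ℓ a) = 0 := by
      intro n1 hn1 n2 hn2 hne
      rw [mem_range] at hn1 hn2
      have hk : -1 ≤ upperIndex ℓ a n1 n2 := by rw [upperIndex]; omega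
      obtain ⟨b, hb, hb'⟩ : ∃ b, WeightLE (Pi.single a.castSucc 1)
          (arBPoly B ℓ (upperIndex ℓ a n1 n2) 0 a) b ∧
          1 + (if n1 ≠ 0 then 1 else 0) + b < 2 * (ℓ - 1 - (a : ℕ)) + 1 := by
        by_cases hn : n1 = 1
        · refine ⟨_, weightLE_arBPoly_even hB ?_ ⟨(ℓ : ℤ) - a - 2 - n2, ?_⟩ 0 a, ?_⟩
          · rw [upperIndex]; omega
          · rw [upperIndex]; omega
          · rw [if_pos (by omega), upperIndex]; omega
        · refine ⟨_, weightLE_arBPoly hk 0 a (M := 1) ?_ ?_, ?_⟩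
          · rw [single_castSucc, if_pos rfl]
          · rw [single_castSucc_last]; exact Nat.zero_le _
          · rw [upperIndex]
            split_ifs <;> omega
      refine (((weightLE_single_linear h a le_rfl).mul
        (weightLE_single_subsetFactor a ∅ (Jset ℓ a))).mul
        ((((neg_one_pow_weightLE _).mul (weightLE_single_esym_pair h a le_rfl n1)).mul
          (weightLE_single_esym_upper a le_rfl n2)).mul hb)).coeff_eq_zero ?_
      rw [Finsupp.weight_single_one_apply, diagExp_self]
      simp only [hJ, if_false, notMem_empty, if_true, true_and]
      omega
    rw [sum_eq_single_of_mem 0 (by simp), sum_eq_single_of_mem 0 (by rw [mem_range]; omega),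
      coeff_main_summand hB h]
    · exact fun n2 hn2 hne => hz 0 (by simp) n2 hn2 (Or.inr hne)
    · exact fun n1 hn1 hne => sum_eq_zero fun n2 hn2 => hz n1 hn1 n2 hn2 (Or.inl hne)
  · intro K1 K2 _ _ c hc hK
    have hca : c < a := by simpa [Jset] using hc
    refine sum_eq_zero fun n1 hn1 => sum_eq_zero fun n2 hn2 => ?_
    rw [mem_range] at hn1 hn2
    refine coeff_diagExp_eq_zero hca hK ?_ ?_
    · simpa [hca.ne'] using weightLE_single_linear h c hca.le
    · simpa [hca.ne'] using weightLE_single_symSummand (B := B) h hca.le hca.ne'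
        ((a : ℕ) - K1.card - K2.card) hn1 hn2

end Model

/-! ### The determinant -/

section Determinant

variable {B : ℤ → ℕ → Polynomial ℝ} {ℓ : ℕ}

theorem le_two_of_mem_support {j i : Fin ℓ} {d : Fin (ℓ + 1) →₀ ℕ}
    (hd : d ∈ (phiPoly B ℓ j i).support) {c : Fin (ℓ + 1)} (hci : c < i.castSucc)
    (hcj : c ≤ j.castSucc) : d c ≤ 2 := by
  obtain ⟨c, rfl⟩ := Fin.exists_castSucc_eq.2 (hci.trans (Fin.castSucc_lt_last i)).ne
  have := weightLE_single_phiPoly (B := B) (Fin.castSucc_lt_castSucc_iff.1 hci)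
    (Fin.castSucc_le_castSucc_iff.1 hcj) d hd
  rwa [Finsupp.weight_single_one_apply] at this

theorem sum_le_of_mem_support {j i : Fin ℓ} {d : Fin (ℓ + 1) →₀ ℕ}
    (hd : d ∈ (phiPoly B ℓ j i).support) : ∑ c, d c ≤ 2 * ℓ - 1 := by
  have := weightLE_phiPoly (B := B) (w := fun _ => 1) (r := 1) (fun _ => le_rfl) j i le_rfl
    (fun _ => ⟨le_rfl, le_rfl⟩) d hd
  rw [Finsupp.weight_eq_sum] at this
  simp only [smul_eq_mul, mul_one] at this
  have := i.isLt
  omega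

theorem sum_Iic_le_of_mem_support {j i : Fin ℓ} (hij : i < j) {d : Fin (ℓ + 1) →₀ ℕ}
    (hd : d ∈ (phiPoly B ℓ j i).support) : ∑ c ∈ Iic i.castSucc, d c < 2 * ℓ - 1 := by
  have hij' := Fin.lt_def.1 hij
  have := weightLE_phiPoly (B := B) (w := fun c => if c ≤ i.castSucc then 1 else 0) (r := 0)
    (fun c => by split_ifs <;> simp) j i
    (by rw [if_neg (by simpa using hij)])
    (fun h => ⟨by rw [if_neg (by rw [Fin.le_def]; simp; omega)],
      by rw [if_neg (not_le.2 (Fin.castSucc_lt_last i))]⟩) d hd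
  rw [Finsupp.weight_eq_sum] at this
  simp only [smul_eq_mul, mul_ite, mul_one, mul_zero] at this
  rw [← sum_filter] at this
  have hI : (univ.filter fun c : Fin (ℓ + 1) => c ≤ i.castSucc) = Iic i.castSucc := by
    ext c
    simp
  rw [hI] at this
  have := i.isLt
  omega

theorem toLex_le_diagExp {a : Fin ℓ} {d : Fin (ℓ + 1) →₀ ℕ}
    (hd : d ∈ (phiPoly B ℓ a a).support) : toLex d ≤ toLex (diagExp ℓ a) := by
  refine toLex_le_of_sum_le a.castSucc (fun c hc => ?_) ?_ fun c hc => diagExp_of_gt hc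
  · refine (le_two_of_mem_support hd hc hc.le).trans_eq ?_
    obtain ⟨c, rfl⟩ := Fin.exists_castSucc_eq.2 (hc.trans (Fin.castSucc_lt_last a)).ne
    rw [diagExp_of_lt (Fin.castSucc_lt_castSucc_iff.1 hc)]
  · rw [sum_diagExp]
    exact sum_le_of_mem_support hd

/-- The off-diagonal products in the expansion of the determinant have smaller monomials. -/
theorem toLex_lt_of_ne_one {σ : Equiv.Perm (Fin ℓ)} (hσ : σ ≠ 1) {d : Fin (ℓ + 1) →₀ ℕ}
    (hd : d ∈ (∏ a, phiPoly B ℓ (σ a) a).support) : toLex d < toLex (∑ a, diagExp ℓ a) := by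
  obtain ⟨m, hm, rfl⟩ := exists_sum_of_mem_support_prod _ _ hd
  have hne : (univ.filter fun a => σ a ≠ a).Nonempty := by
    by_contra h
    rw [not_nonempty_iff_eq_empty, filter_eq_empty_iff] at h
    exact hσ (Equiv.ext fun a => by simpa using h (mem_univ a))
  set i := (univ.filter fun a => σ a ≠ a).min' hne with hi
  have hσi : σ i ≠ i := by simpa using min'_mem _ hne
  have hfix : ∀ a < i, σ a = a := by
    intro a ha
    by_contra h
    exact absurd (min'_le (univ.filter fun a => σ a ≠ a) a (by simp [h])) (not_le.2 ha)
  have hge : ∀ a, i ≤ a → i ≤ σ a := by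
    intro a ha
    by_contra h
    have h' := hfix (σ a) (not_le.1 h)
    rw [σ.injective h'] at h
    exact h ha
  have hgt : i < σ i := lt_of_le_of_ne (hge i le_rfl) hσi.symm
  rw [← sum_filter_add_sum_filter_not univ (fun a => a < i) m,
    ← sum_filter_add_sum_filter_not univ (fun a => a < i) (diagExp ℓ), toLex_add, toLex_add]
  refine add_lt_add_of_le_of_lt ?_ ?_
  · rw [← MonomialOrder.lex_le_iff, map_sum, map_sum]
    refine sum_le_sum fun a ha => ?_
    have h1 := hm a (mem_univ a)
    rw [hfix a (mem_filter.1 ha).2] at h1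
    exact toLex_le_diagExp h1
  · have hpt : ∀ a, i < a → ∀ c ≤ i.castSucc, m a c ≤ diagExp ℓ a c := by
      intro a ha c hc
      have hca : c < a.castSucc := hc.trans_lt (Fin.castSucc_lt_castSucc_iff.2 ha)
      refine (le_two_of_mem_support (hm a (mem_univ a)) hca
        (hc.trans (Fin.castSucc_le_castSucc_iff.2 (hge a ha.le)))).trans_eq ?_
      obtain ⟨c, rfl⟩ := Fin.exists_castSucc_eq.2 (hca.trans (Fin.castSucc_lt_last a)).ne
      rw [diagExp_of_lt (Fin.castSucc_lt_castSucc_iff.1 hca)]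
    refine toLex_lt_of_sum_lt i.castSucc (fun c hc => ?_) ?_
    · rw [Finsupp.finsetSum_apply, Finsupp.finsetSum_apply]
      refine sum_le_sum fun a ha => ?_
      rcases (not_lt.1 (mem_filter.1 ha).2).eq_or_lt with h | h
      · rw [← h]
        refine (le_two_of_mem_support (hm i (mem_univ i)) hc
          (hc.le.trans (Fin.castSucc_le_castSucc_iff.2 hgt.le))).trans_eq ?_
        obtain ⟨c, rfl⟩ := Fin.exists_castSucc_eq.2 (hc.trans (Fin.castSucc_lt_last i)).ne
        rw [diagExp_of_lt (Fin.castSucc_lt_castSucc_iff.1 hc)]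
      · exact hpt a h c hc.le
    · simp only [Finsupp.finsetSum_apply]
      rw [sum_comm, sum_comm (s := Iic i.castSucc) (f := fun c a => diagExp ℓ a c)]
      have hlt : ∑ c ∈ Iic i.castSucc, m i c < ∑ c ∈ Iic i.castSucc, diagExp ℓ i c := by
        rw [sum_Iic_diagExp]
        exact sum_Iic_le_of_mem_support hgt (hm i (mem_univ i))
      refine sum_lt_sum (fun a ha => ?_) ⟨i, by simp, hlt⟩
      rcases (not_lt.1 (mem_filter.1 ha).2).eq_or_lt with h | h
      · rw [← h]
        exact hlt.le
      · exact sum_le_sum fun c hc => hpt a h c (mem_Iic.1 hc)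

/-- The polynomial `(∏ x_i) * det M`. -/
def detPoly (B : ℤ → ℕ → Polynomial ℝ) (ℓ : ℕ) : SS ℓ :=
  Matrix.det (Matrix.of fun i j : Fin ℓ => phiPoly B ℓ j i)

theorem detPoly_eq_sum :
    detPoly B ℓ = ∑ σ : Equiv.Perm (Fin ℓ), ((Equiv.Perm.sign σ : ℤ) : SS ℓ) *
      ∏ a, phiPoly B ℓ (σ a) a := by
  rw [detPoly, ← Matrix.det_transpose, Matrix.det_apply']
  rfl

theorem mem_support_of_mem_support_sign_mul (σ : Equiv.Perm (Fin ℓ)) {f : SS ℓ}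
    {d : Fin (ℓ + 1) →₀ ℕ} (hd : d ∈ (((Equiv.Perm.sign σ : ℤ) : SS ℓ) * f).support) :
    d ∈ f.support := by
  rcases Int.units_eq_one_or (Equiv.Perm.sign σ) with h | h <;> simpa [h] using hd

theorem algebraMap_detPoly (hB : BProp B) :
    algebraMap (SS ℓ) (KK ℓ) (detPoly B ℓ)
      = (∏ i, xx ℓ i) * Matrix.det (Matrix.of fun i j : Fin ℓ => phi B ℓ j i) := by
  rw [detPoly, RingHom.map_det, ← Matrix.det_mul_column]
  congr 1
  ext i j
  simp [algebraMap_phiPoly hB]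

theorem toLex_le_of_mem_support_detPoly {d : Fin (ℓ + 1) →₀ ℕ}
    (hd : d ∈ (detPoly B ℓ).support) : toLex d ≤ toLex (∑ a, diagExp ℓ a) := by
  rw [detPoly_eq_sum] at hd
  obtain ⟨σ, _, hd⟩ := mem_biUnion.1 (support_sum hd)
  replace hd := mem_support_of_mem_support_sign_mul σ hd
  by_cases hσ : σ = 1
  · subst hσ
    obtain ⟨m, hm, rfl⟩ := exists_sum_of_mem_support_prod _ _ hd
    rw [← MonomialOrder.lex_le_iff, map_sum, map_sum]
    exact sum_le_sum fun a ha => toLex_le_diagExp (hm a ha)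
  · exact (toLex_lt_of_ne_one hσ hd).le

theorem coeff_detPoly (hB : BProp B) (hℓ : 2 ≤ ℓ) :
    (detPoly B ℓ).coeff (∑ a, diagExp ℓ a)
      = (∏ m ∈ range (ℓ - 1), (2 * (m : ℝ) + 1))⁻¹ := by
  rw [detPoly_eq_sum, coeff_sum, sum_eq_single_of_mem 1 (mem_univ _)]
  · rw [Equiv.Perm.sign_one, Units.val_one, Int.cast_one, one_mul]
    simp only [Equiv.Perm.one_apply]
    rw [coeff_prod_of_toLex_le univ _ (diagExp ℓ) fun a _ d hd => toLex_le_diagExp hd]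
    obtain ⟨n, rfl⟩ : ∃ n, ℓ = n + 1 := ⟨ℓ - 1, by omega⟩
    have hcast (a : Fin n) : (phiPoly B (n + 1) a.castSucc a.castSucc).coeff
        (diagExp (n + 1) a.castSucc) = (2 * ((n - 1 - a : ℕ) : ℝ) + 1)⁻¹ := by
      rw [coeff_phiPoly_of_lt hB (by simp)]
      simp
    rw [Fin.prod_univ_castSucc]
    simp only [hcast]
    rw [coeff_phiPoly_last (by simp), mul_one, Nat.add_sub_cancel, ← prod_inv_distrib,
      ← prod_range_reflect, Fin.prod_univ_eq_prod_range (fun a => (2 * ((n - 1 - a : ℕ) : ℝ) + 1)⁻¹)]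
  · intro σ _ hσ
    by_contra h
    exact (toLex_lt_of_ne_one hσ
      (mem_support_of_mem_support_sign_mul σ (mem_support_iff.2 h))).false

end Determinant

/-- Let `ℓ ≥ 2` and let `M = (φ_j(x_i))_{1≤i,j≤ℓ}`.  Then `det M` is nonzero, its
initial monomial in the pure lexicographic order is `∏_{i=1}^{ℓ−1} x_i^{4(ℓ−i)}`,
and its leading term is `(1/(2ℓ−3)!!)·∏_{i=1}^{ℓ−1} x_i^{4(ℓ−i)}`, where
`(2ℓ−3)!! = ∏_{m=1}^{ℓ−1}(2m−1)`.  (Formally: `det M` is the image of a polynomial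
`P`; for every such `P`, the above monomial occurs in `P`, every monomial of `P` is
lexicographically at most this one, and its coefficient in `P` is `1/(2ℓ−3)!!`.) -/
theorem det_phi_initial (B : ℤ → ℕ → Polynomial ℝ) (hB : BProp B)
    (ℓ : ℕ) (hℓ : 2 ≤ ℓ) :
    Matrix.det (Matrix.of fun i j : Fin ℓ => phi B ℓ j i) ≠ 0 ∧
    ∀ P : SS ℓ,
      algebraMap (SS ℓ) (KK ℓ) P = Matrix.det (Matrix.of fun i j : Fin ℓ => phi B ℓ j i) →
        P ≠ 0 ∧ expoD ℓ ∈ P.support ∧ (∀ d ∈ P.support, toLex d ≤ toLex (expoD ℓ)) ∧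
          P.coeff (expoD ℓ) = (∏ m ∈ Finset.range (ℓ - 1), (2 * (m : ℝ) + 1))⁻¹ := by
  have hcoeff := coeff_detPoly hB hℓ
  have hpos : (∏ m ∈ Finset.range (ℓ - 1), (2 * (m : ℝ) + 1))⁻¹ ≠ 0 :=
    inv_ne_zero (Finset.prod_ne_zero_iff.2 fun m _ => by positivity)
  refine ⟨fun h0 => ?_, fun P hP => ?_⟩
  · have h1 := algebraMap_detPoly (ℓ := ℓ) hB
    rw [h0, mul_zero, FaithfulSMul.algebraMap_eq_zero_iff] at h1
    rw [h1, coeff_zero] at hcoeff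
    exact hpos hcoeff.symm
  · have hmon : (∏ i, xVar ℓ i) = monomial (∑ a : Fin ℓ, Finsupp.single a.castSucc 1) (1 : ℝ) := by
      rw [monomial_sum_one]
      rfl
    have hdet : detPoly B ℓ
        = P * monomial (∑ a : Fin ℓ, Finsupp.single a.castSucc 1) (1 : ℝ) := by
      apply FaithfulSMul.algebraMap_injective (SS ℓ) (KK ℓ)
      rw [algebraMap_detPoly hB, ← hmon, map_mul, hP, map_prod, mul_comm]
      rfl
    have hshift (d) : P.coeff d
        = (detPoly B ℓ).coeff (d + ∑ a : Fin ℓ, Finsupp.single a.castSucc 1) := by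
      rw [hdet, coeff_mul_monomial, mul_one]
    have hP' : P.coeff (expoD ℓ) = (∏ m ∈ Finset.range (ℓ - 1), (2 * (m : ℝ) + 1))⁻¹ := by
      rw [hshift, ← sum_diagExp_eq, hcoeff]
    refine ⟨?_, ?_, fun d hd => ?_, hP'⟩
    · rintro rfl
      rw [coeff_zero] at hP'
      exact hpos hP'.symm
    · rw [mem_support_iff, hP']
      exact hpos
    · have h1 := toLex_le_of_mem_support_detPoly (B := B)
        (mem_support_iff.2 (hshift d ▸ mem_support_iff.1 hd))
      rw [sum_diagExp_eq, toLex_add, toLex_add] at h1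
      exact le_of_add_le_add_right h1

end
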